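/- Let r ≥ 0, x₁ > x₂ > x₃ > 0, and k ≥ 2 an integer. Define on 𝒲 = {(λ₁,λ₂,λ₃) : λ₁ > λ₂ > λ₃ > 0} the function φ(λ) = |det[f_r(x_i λ_j)]_{i,j=1..3}|^{2k} / ∏_{1≤i<j≤3}(λ_i²−λ_j²)^{2k−2} · (λ₁λ₂λ₃)^{1+2r}, where f_r(s) = J_r(s)/s^r. Then ∫_𝒲 φ dλ < ∞. -/

import Mathlib

open MeasureTheory

/-- Bessel function of the first kind of natural order `r`, via its power series. -/
noncomputable def besselJ (r : ℕ) (s : ℝ) : ℝ :=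
  ∑' l : ℕ, ((-1 : ℝ)) ^ l * (s / 2) ^ (2 * l + r) / ((l.factorial : ℝ) * ((r + l).factorial : ℝ))

/-- The entire function `g` with `J_r(s) = s ^ r * g (s ^ 2)`. -/
noncomputable def besselG (r : ℕ) (t : ℝ) : ℝ :=
  ∑' l : ℕ, (-1 : ℝ) ^ l * t ^ l / (2 ^ (2 * l + r) * (l.factorial : ℝ) * ((r + l).factorial : ℝ))

lemma besselG_coeff_bound (r l : ℕ) (t : ℝ) :
    |(-1 : ℝ) ^ l * t ^ l / (2 ^ (2 * l + r) * (l.factorial : ℝ) * ((r + l).factorial : ℝ))|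
      ≤ |t| ^ l / l.factorial := by
  have h1 : (1 : ℝ) ≤ 2 ^ (2 * l + r) := one_le_pow₀ (by norm_num)
  have h2 : (1 : ℝ) ≤ (r + l).factorial := by exact_mod_cast Nat.factorial_pos _
  have h3 : (0 : ℝ) < l.factorial := by positivity
  rw [abs_div, abs_mul, abs_pow, abs_neg, abs_one, one_pow, one_mul, abs_pow,
    abs_of_pos (a := (2 : ℝ) ^ (2 * l + r) * l.factorial * (r + l).factorial) (by positivity)]
  apply div_le_div_of_nonneg_left (by positivity) h3
  nlinarith [one_le_mul_of_one_le_of_one_le h1 h2]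

lemma summable_besselG (r : ℕ) (t : ℝ) : Summable fun l : ℕ =>
    (-1 : ℝ) ^ l * t ^ l / (2 ^ (2 * l + r) * (l.factorial : ℝ) * ((r + l).factorial : ℝ)) :=
  Summable.of_norm_bounded (Real.summable_pow_div_factorial |t|)
    fun l => besselG_coeff_bound r l t

lemma hasDerivAt_besselG (r : ℕ) (t : ℝ) :
    HasDerivAt (besselG r) (-(1 / 2) * besselG (r + 1) t) t := by
  set R : ℝ := |t| + 1
  have hterm : ∀ (l : ℕ) (y : ℝ),
      ((-1 : ℝ) ^ (l + 1) * (((l + 1 : ℕ) : ℝ) * y ^ l)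
        / (2 ^ (2 * (l + 1) + r) * ((l + 1).factorial : ℝ) * ((r + (l + 1)).factorial : ℝ)))
      = -(1 / 2) * ((-1 : ℝ) ^ l * y ^ l
        / (2 ^ (2 * l + (r + 1)) * (l.factorial : ℝ) * ((r + 1 + l).factorial : ℝ))) := by
    intro l y
    have e : r + (l + 1) = r + 1 + l := by ring
    rw [e, Nat.factorial_succ l]
    push_cast
    have : (0 : ℝ) < l.factorial := by positivity
    have : (0 : ℝ) < (r + 1 + l).factorial := by positivity
    field_simp
    ring
  have hsum : Summable fun l : ℕ => match l with
      | 0 => (0 : ℝ)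
      | l + 1 => R ^ l / l.factorial := by
    rw [← summable_nat_add_iff 1]
    exact Real.summable_pow_div_factorial R
  have key := hasDerivAt_tsum_of_isPreconnected (t := Metric.ball (0 : ℝ) R) (y₀ := t) (y := t)
    (g := fun (l : ℕ) (y : ℝ) => (-1 : ℝ) ^ l * y ^ l
      / (2 ^ (2 * l + r) * (l.factorial : ℝ) * ((r + l).factorial : ℝ)))
    (g' := fun (l : ℕ) (y : ℝ) => (-1 : ℝ) ^ l * ((l : ℝ) * y ^ (l - 1))
      / (2 ^ (2 * l + r) * (l.factorial : ℝ) * ((r + l).factorial : ℝ)))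
    hsum Metric.isOpen_ball (convex_ball _ _).isPreconnected
    (fun l y _ => ((hasDerivAt_pow l y).const_mul _).div_const _) ?_
    (by simp [R]) (summable_besselG r t) (by simp [R])
  · rw [Summable.tsum_eq_zero_add] at key
    · simp only [Nat.add_sub_cancel, hterm, tsum_mul_left, Nat.cast_zero, zero_mul, mul_zero,
        zero_div, zero_add] at key
      exact key
    · rw [← summable_nat_add_iff 1]
      simp only [Nat.add_sub_cancel, hterm]
      exact (summable_besselG (r + 1) t).mul_left _
  · rintro (_ | l) y hy
    · simp
    · simp only [Nat.add_sub_cancel, hterm, norm_mul]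
      have hy : |y| ≤ R := by simpa using (Metric.mem_ball.1 hy).le
      have h1 := besselG_coeff_bound (r + 1) l y
      have h2 : |y| ^ l / l.factorial ≤ R ^ l / l.factorial := by gcongr
      simp only [Real.norm_eq_abs] at *
      rw [show |(-(1 / 2) : ℝ)| = 1 / 2 by norm_num]
      linarith [abs_nonneg ((-1 : ℝ) ^ l * y ^ l
        / (2 ^ (2 * l + (r + 1)) * (l.factorial : ℝ) * ((r + 1 + l).factorial : ℝ)))]

lemma besselG_recurrence (r : ℕ) (t : ℝ) :
    t * besselG (r + 2) t = 2 * (r + 1) * besselG (r + 1) t - besselG r t := by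
  have h0 : Summable fun l : ℕ => 2 * ((r : ℝ) + 1) * ((-1 : ℝ) ^ l * t ^ l
        / (2 ^ (2 * l + (r + 1)) * (l.factorial : ℝ) * ((r + 1 + l).factorial : ℝ)))
      - (-1 : ℝ) ^ l * t ^ l / (2 ^ (2 * l + r) * (l.factorial : ℝ) * ((r + l).factorial : ℝ)) :=
    ((summable_besselG (r + 1) t).mul_left _).sub (summable_besselG r t)
  simp only [besselG]
  rw [← tsum_mul_left, ← tsum_mul_left,
    ← ((summable_besselG (r + 1) t).mul_left _).tsum_sub (summable_besselG r t),
    h0.tsum_eq_zero_add]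
  have hz : 2 * ((r : ℝ) + 1) * ((-1 : ℝ) ^ 0 * t ^ 0
        / (2 ^ (2 * 0 + (r + 1)) * (Nat.factorial 0 : ℝ) * ((r + 1 + 0).factorial : ℝ)))
      - (-1 : ℝ) ^ 0 * t ^ 0 / (2 ^ (2 * 0 + r) * (Nat.factorial 0 : ℝ) * ((r + 0).factorial : ℝ))
      = 0 := by
    simp only [Nat.factorial_succ, Nat.add_zero, Nat.factorial_zero]
    push_cast
    have : (0 : ℝ) < r.factorial := by positivity
    field_simp
    ring
  rw [hz, zero_add]
  congr 1
  ext l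
  rw [show r + 1 + (l + 1) = (r + l + 1) + 1 by ring, show r + 2 + l = (r + l + 1) + 1 by ring,
    show r + (l + 1) = r + l + 1 by ring, Nat.factorial_succ (r + l + 1), Nat.factorial_succ l]
  push_cast
  have : (0 : ℝ) < l.factorial := by positivity
  have : (0 : ℝ) < (r + l + 1).factorial := by positivity
  field_simp
  ring

lemma besselJ_div_pow (r : ℕ) {s : ℝ} (hs : s ≠ 0) : besselJ r s / s ^ r = besselG r (s ^ 2) := by
  rw [besselJ, besselG, ← tsum_div_const]
  congr 1
  ext l
  rw [div_pow, pow_add, pow_mul]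
  field_simp

lemma continuous_besselG (r : ℕ) : Continuous (besselG r) :=
  continuous_iff_continuousAt.2 fun t => (hasDerivAt_besselG r t).continuousAt

lemma hasDerivAt_besselG_sq (r : ℕ) (s : ℝ) :
    HasDerivAt (fun s => besselG r (s ^ 2)) (-(s * besselG (r + 1) (s ^ 2))) s := by
  refine ((hasDerivAt_besselG r (s ^ 2)).comp s (hasDerivAt_pow 2 s)).congr_deriv ?_
  push_cast
  ring

/-- The energy `u ^ 2 + u' ^ 2` of `u = s ^ (1 / 2) * J_r(s)`. -/
noncomputable def besselEnergy (r : ℕ) (s : ℝ) : ℝ :=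
  s ^ (2 * r) * (s * besselG r (s ^ 2) ^ 2
    + ((r + 1 / 2) * besselG r (s ^ 2) - s ^ 2 * besselG (r + 1) (s ^ 2)) ^ 2 / s)

lemma hasDerivAt_besselEnergy (r : ℕ) {s : ℝ} (hs : 0 < s) :
    HasDerivAt (besselEnergy r)
      (s ^ (2 * r) / s ^ 2 * (2 * ((r : ℝ) ^ 2 - 1 / 4) * (besselG r (s ^ 2) *
        ((r + 1 / 2) * besselG r (s ^ 2) - s ^ 2 * besselG (r + 1) (s ^ 2))))) s := by
  have hp : HasDerivAt (fun s : ℝ => s ^ (2 * r)) (2 * r * s ^ (2 * r) / s) s := by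
    refine (hasDerivAt_pow (2 * r) s).congr_deriv ?_
    rcases r with _ | r
    · simp
    · rw [show 2 * (r + 1) - 1 = 2 * r + 1 by omega, show 2 * (r + 1) = 2 * r + 1 + 1 by ring,
        pow_succ s (2 * r + 1)]
      push_cast
      field_simp
      ring
  have hF := hasDerivAt_besselG_sq r s
  have hG := hasDerivAt_besselG_sq (r + 1) s
  have hP := (hF.const_mul ((r : ℝ) + 1 / 2)).sub ((hasDerivAt_pow 2 s).mul hG)
  have hE := hp.mul (((hasDerivAt_id s).mul (hF.pow 2)).add
    ((hP.pow 2).div (hasDerivAt_id s) hs.ne'))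
  refine hE.congr_deriv ?_
  have hrec : s * (s * besselG (r + 1 + 1) (s ^ 2))
      = 2 * (r + 1) * besselG (r + 1) (s ^ 2) - besselG r (s ^ 2) := by
    rw [← besselG_recurrence]; ring
  have hH : besselG (r + 1 + 1) (s ^ 2)
      = (2 * (r + 1) * besselG (r + 1) (s ^ 2) - besselG r (s ^ 2)) / s ^ 2 := by
    rw [← hrec]; field_simp
  simp only [Pi.add_apply, Pi.mul_apply, Pi.pow_apply, Pi.sub_apply, Pi.div_apply, id, hH]
  push_cast
  field_simp
  ring

lemma besselEnergy_le (r : ℕ) {s : ℝ} (hs : 1 ≤ s) :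
    besselEnergy r s ≤ besselEnergy r 1 * Real.exp (r ^ 2 + 1) := by
  set K : ℝ := (r : ℝ) ^ 2 + 1 with hK
  have hd : ∀ s : ℝ, 0 < s → HasDerivAt (fun s => besselEnergy r s * Real.exp (K / s))
      (s ^ (2 * r) / s ^ 2 * (2 * ((r : ℝ) ^ 2 - 1 / 4) * (besselG r (s ^ 2) *
        ((r + 1 / 2) * besselG r (s ^ 2) - s ^ 2 * besselG (r + 1) (s ^ 2)))) * Real.exp (K / s)
        + besselEnergy r s * (Real.exp (K / s) * (-K / s ^ 2))) s := by
    intro s hs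
    refine (hasDerivAt_besselEnergy r hs).mul (HasDerivAt.exp ?_)
    refine ((hasDerivAt_inv hs.ne').const_mul K).congr_deriv ?_
    ring
  have hanti : AntitoneOn (fun s => besselEnergy r s * Real.exp (K / s)) (Set.Ici 1) := by
    refine antitoneOn_of_hasDerivWithinAt_nonpos (convex_Ici 1)
      (fun s hs => (hd s (lt_of_lt_of_le one_pos hs)).continuousAt.continuousWithinAt)
      (fun s hs => (hd s ?_).hasDerivWithinAt) ?_
    · rw [interior_Ici] at hs
      exact one_pos.trans hs
    · intro s hs
      rw [interior_Ici] at hs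
      have hs0 : 0 < s := one_pos.trans hs
      set F := besselG r (s ^ 2)
      set P := (r + 1 / 2) * F - s ^ 2 * besselG (r + 1) (s ^ 2) with hP
      have hE : besselEnergy r s = s ^ (2 * r) * (s * F ^ 2 + P ^ 2 / s) := rfl
      have h1 : 2 * |F * P| ≤ s * F ^ 2 + P ^ 2 / s := by
        have e : s * F ^ 2 + P ^ 2 / s - 2 * |F * P| = (s * |F| - |P|) ^ 2 / s := by
          rw [abs_mul, ← sq_abs F, ← sq_abs P]; field_simp; ring
        have : 0 ≤ (s * |F| - |P|) ^ 2 / s := by positivity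
        linarith
      have h2 : 2 * ((r : ℝ) ^ 2 - 1 / 4) * (F * P) ≤ K * (s * F ^ 2 + P ^ 2 / s) := by
        calc 2 * ((r : ℝ) ^ 2 - 1 / 4) * (F * P) ≤ |2 * ((r : ℝ) ^ 2 - 1 / 4) * (F * P)| :=
              le_abs_self _
          _ = |(r : ℝ) ^ 2 - 1 / 4| * (2 * |F * P|) := by
              rw [abs_mul, abs_mul, abs_two]; ring
          _ ≤ K * (s * F ^ 2 + P ^ 2 / s) := by
              refine mul_le_mul ?_ h1 (by positivity) (by positivity)
              rw [abs_le]; constructor <;> nlinarith [sq_nonneg (r : ℝ)]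
      rw [hE]
      have h3 : 0 ≤ s ^ (2 * r) / s ^ 2 * Real.exp (K / s) := by positivity
      have h4 := mul_le_mul_of_nonneg_left h2 h3
      calc _ = s ^ (2 * r) / s ^ 2 * Real.exp (K / s) * (2 * ((r : ℝ) ^ 2 - 1 / 4) * (F * P))
            - s ^ (2 * r) / s ^ 2 * Real.exp (K / s) * (K * (s * F ^ 2 + P ^ 2 / s)) := by ring
        _ ≤ 0 := by linarith
  have h := hanti (Set.mem_Ici.2 le_rfl) (Set.mem_Ici.2 hs) hs
  simp only [div_one] at h
  refine le_trans (le_mul_of_one_le_right ?_ (Real.one_le_exp (by positivity))) h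
  unfold besselEnergy
  positivity

lemma exists_pow_mul_besselG_sq_le (r m : ℕ) (hm : m ≤ 2 * r + 1) :
    ∃ C, ∀ s, 0 ≤ s → s ^ m * besselG r (s ^ 2) ^ 2 ≤ C := by
  have hc : Continuous fun s : ℝ => s ^ m * besselG r (s ^ 2) ^ 2 := by
    have := continuous_besselG r
    fun_prop
  obtain ⟨C, hC⟩ := (isCompact_Icc (a := (0 : ℝ)) (b := 1)).exists_bound_of_continuousOn
    hc.continuousOn
  refine ⟨max C (besselEnergy r 1 * Real.exp (r ^ 2 + 1)), fun s hs => ?_⟩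
  rcases le_total s 1 with h | h
  · exact le_max_of_le_left ((le_abs_self _).trans (hC s ⟨hs, h⟩))
  · refine le_max_of_le_right (le_trans ?_ (besselEnergy_le r h))
    calc s ^ m * besselG r (s ^ 2) ^ 2 ≤ s ^ (2 * r + 1) * besselG r (s ^ 2) ^ 2 := by gcongr
      _ = s ^ (2 * r) * (s * besselG r (s ^ 2) ^ 2) := by ring
      _ ≤ besselEnergy r s := by
        unfold besselEnergy
        gcongr
        exact le_add_of_nonneg_right (by positivity)

lemma exists_abs_pow_mul_besselG_le (r m : ℕ) (hm : 4 * m ≤ 2 * r + 1) :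
    ∃ C, ∀ t, 0 ≤ t → t ^ m * |besselG r t| ≤ C := by
  obtain ⟨C, hC⟩ := exists_pow_mul_besselG_sq_le r (4 * m) hm
  refine ⟨√C, fun t ht => Real.le_sqrt_of_sq_le ?_⟩
  have h := hC √t (Real.sqrt_nonneg t)
  rw [Real.sq_sqrt ht, show 4 * m = 2 * (m * 2) by ring, pow_mul, Real.sq_sqrt ht] at h
  rwa [mul_pow, sq_abs, ← pow_mul]

/-- Newton interpolation at three ordered positive nodes, with bounds on the coefficients. -/
lemma exists_divided_differences {h h' h'' : ℝ → ℝ} {M : ℝ}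
    (hh : ∀ t, HasDerivAt h (h' t) t) (hh' : ∀ t, HasDerivAt h' (h'' t) t)
    (hM' : ∀ t, 0 ≤ t → |h' t| ≤ M) (hM'' : ∀ t, 0 ≤ t → (1 + t) * |h'' t| ≤ M)
    {a b c : ℝ} (hc : 0 < c) (hcb : c < b) (hba : b < a) :
    ∃ d e, |d| ≤ M ∧ |e| ≤ 4 * M / (1 + a) ∧ h b = h c + d * (b - c) ∧
      h a = h c + d * (a - c) + e * ((a - b) * (a - c)) := by
  have hcont : Continuous h := continuous_iff_continuousAt.2 fun t => (hh t).continuousAt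
  have hcont' : Continuous h' := continuous_iff_continuousAt.2 fun t => (hh' t).continuousAt
  obtain ⟨η, hη, hηe⟩ := exists_hasDerivAt_eq_slope h h' hcb hcont.continuousOn fun t _ => hh t
  obtain ⟨ξ, hξ, hξe⟩ := exists_hasDerivAt_eq_slope h h' hba hcont.continuousOn fun t _ => hh t
  have hηξ : η < ξ := hη.2.trans hξ.1
  obtain ⟨ζ, hζ, hζe⟩ := exists_hasDerivAt_eq_slope h' h'' hηξ hcont'.continuousOn fun t _ => hh' t
  have hη0 : 0 < η := hc.trans hη.1
  have hac : 0 < a - c := by linarith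
  have hM0 : 0 ≤ M := (abs_nonneg _).trans (hM' 0 le_rfl)
  have hd1 := hM' η hη0.le
  have hd2 := hM' ξ (hη0.trans hηξ).le
  rw [eq_div_iff (by linarith)] at hηe hξe hζe
  refine ⟨h' η, (h' ξ - h' η) / (a - c), hd1, ?_, by linarith, ?_⟩
  · rw [abs_div, abs_of_pos hac, div_le_div_iff₀ hac (by linarith)]
    rcases le_total (2 * c + 1) a with hca | hca
    · have h1 : |h' ξ - h' η| ≤ 2 * M := (abs_sub _ _).trans (by linarith)
      nlinarith [abs_nonneg (h' ξ - h' η)]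
    · have h2 := hM'' ζ (hη0.trans hζ.1).le
      rw [← hζe, abs_mul, abs_of_pos (sub_pos.2 hηξ)]
      have h3 : 1 + a ≤ 4 * (1 + ζ) := by linarith [hζ.1, hη.1]
      have h4 : ξ - η ≤ a - c := by linarith [hξ.2, hη.1]
      calc |h'' ζ| * (ξ - η) * (1 + a) ≤ |h'' ζ| * (a - c) * (4 * (1 + ζ)) := by
            have : 0 ≤ 1 + a := by linarith
            gcongr
        _ = 4 * ((1 + ζ) * |h'' ζ|) * (a - c) := by ring
        _ ≤ 4 * M * (a - c) := by gcongr
  · field_simp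
    linear_combination (-1 : ℝ) * hξe - hηe

lemma Matrix.abs_det_le_factorial_mul_prod {n : Type*} [Fintype n] [DecidableEq n]
    (A : Matrix n n ℝ) (b : n → ℝ) (h : ∀ i j, |A i j| ≤ b j) :
    |A.det| ≤ (Fintype.card n).factorial * ∏ j, b j := by
  rw [Matrix.det_apply]
  refine (Finset.abs_sum_le_sum_abs _ _).trans ?_
  rw [← Fintype.card_perm, ← nsmul_eq_mul, ← Finset.card_univ]
  refine Finset.sum_le_card_nsmul _ _ _ fun σ _ => ?_
  have : |Equiv.Perm.sign σ • ∏ i, A (σ i) i| = ∏ i, |A (σ i) i| := by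
    rw [← Finset.abs_prod]
    rcases Int.units_eq_one_or (Equiv.Perm.sign σ) with h | h <;> simp [h]
  rw [this]
  exact Finset.prod_le_prod (fun _ _ => abs_nonneg _) fun i _ => h _ _

lemma exists_abs_det_le_vandermonde (r : ℕ) (x : Fin 3 → ℝ) (hx : ∀ i, 0 < x i) :
    ∃ C, 0 ≤ C ∧ ∀ t : Fin 3 → ℝ, 0 < t 2 → t 2 < t 1 → t 1 < t 0 →
      |(Matrix.of fun i j => besselG r (x i ^ 2 * t j)).det|
        ≤ C / (1 + t 0) * ((t 0 - t 1) * (t 0 - t 2) * (t 1 - t 2)) := by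
  obtain ⟨C₀, hC₀⟩ := exists_abs_pow_mul_besselG_le r 0 (by omega)
  obtain ⟨C₁, hC₁⟩ := exists_abs_pow_mul_besselG_le (r + 1) 0 (by omega)
  obtain ⟨C₂, hC₂⟩ := exists_abs_pow_mul_besselG_le (r + 2) 0 (by omega)
  obtain ⟨C₃, hC₃⟩ := exists_abs_pow_mul_besselG_le (r + 2) 1 (by omega)
  simp only [pow_zero, one_mul, pow_one] at hC₀ hC₁ hC₂ hC₃
  obtain ⟨M, hM⟩ : ∃ M, ∀ i, C₀ ≤ M ∧ x i ^ 2 * C₁ ≤ M ∧ x i ^ 4 * C₂ + x i ^ 2 * C₃ ≤ M := by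
    have h : ∀ i, ∃ M, C₀ ≤ M ∧ x i ^ 2 * C₁ ≤ M ∧ x i ^ 4 * C₂ + x i ^ 2 * C₃ ≤ M := fun i =>
      ⟨max C₀ (max (x i ^ 2 * C₁) (x i ^ 4 * C₂ + x i ^ 2 * C₃)), by simp⟩
    choose M hM using h
    refine ⟨max (M 0) (max (M 1) (M 2)), fun i => ?_⟩
    have : M i ≤ max (M 0) (max (M 1) (M 2)) := by fin_cases i <;> simp
    obtain ⟨h1, h2, h3⟩ := hM i
    exact ⟨h1.trans this, h2.trans this, h3.trans this⟩
  have hM0 : 0 ≤ M := (abs_nonneg _).trans ((hC₀ 0 le_rfl).trans (hM 0).1)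
  refine ⟨24 * M ^ 3, by positivity, fun t ht2 ht21 ht10 => ?_⟩
  have hdd : ∀ i, ∃ d e, |d| ≤ M ∧ |e| ≤ 4 * M / (1 + t 0) ∧
      besselG r (x i ^ 2 * t 1) = besselG r (x i ^ 2 * t 2) + d * (t 1 - t 2) ∧
      besselG r (x i ^ 2 * t 0) = besselG r (x i ^ 2 * t 2) + d * (t 0 - t 2)
        + e * ((t 0 - t 1) * (t 0 - t 2)) := by
    intro i
    have hder : ∀ m s, HasDerivAt (fun s => besselG m (x i ^ 2 * s))
        (x i ^ 2 * (-(1 / 2) * besselG (m + 1) (x i ^ 2 * s))) s := fun m s => by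
      refine ((hasDerivAt_besselG m (x i ^ 2 * s)).comp s
        ((hasDerivAt_id s).const_mul (x i ^ 2))).congr_deriv ?_
      ring
    have hxi : 0 < x i ^ 2 := pow_pos (hx i) 2
    refine exists_divided_differences (h := fun s => besselG r (x i ^ 2 * s)) (hder r)
      (fun s => ((hder (r + 1) s).const_mul _).const_mul _) (fun s hs => ?_) (fun s hs => ?_)
      ht2 ht21 ht10
    · have h1 := hC₁ (x i ^ 2 * s) (by positivity)
      rw [abs_mul, abs_mul, abs_of_pos hxi, show |(-(1 / 2) : ℝ)| = 1 / 2 by norm_num]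
      refine le_trans ?_ (hM i).2.1
      gcongr
      linarith [abs_nonneg (besselG (r + 1) (x i ^ 2 * s))]
    · have h2 := hC₂ (x i ^ 2 * s) (by positivity)
      have h3 := hC₃ (x i ^ 2 * s) (by positivity)
      rw [abs_mul, abs_mul, abs_mul, abs_mul, abs_of_pos hxi,
        show |(-(1 / 2) : ℝ)| = 1 / 2 by norm_num]
      refine le_trans ?_ (hM i).2.2
      set g := |besselG (r + 1 + 1) (x i ^ 2 * s)|
      have hg : 0 ≤ g := abs_nonneg _
      calc (1 + s) * (x i ^ 2 * (1 / 2 * (x i ^ 2 * (1 / 2 * g))))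
          ≤ x i ^ 4 * g + x i ^ 2 * (x i ^ 2 * s * g) := by
            have : 0 ≤ x i ^ 4 * (1 + s) * g := by positivity
            linear_combination (3 / 4) * this
        _ ≤ x i ^ 4 * C₂ + x i ^ 2 * C₃ := by
            gcongr
  choose d e hd he h1 h0 using hdd
  set A : Matrix (Fin 3) (Fin 3) ℝ := Matrix.of fun i => ![e i, d i, besselG r (x i ^ 2 * t 2)]
  have hdet : (Matrix.of fun i j => besselG r (x i ^ 2 * t j)).det
      = A.det * ((t 0 - t 1) * (t 0 - t 2) * (t 1 - t 2)) := by
    simp only [Matrix.det_fin_three, Matrix.of_apply, h0, h1, A, Matrix.cons_val_zero,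
      Matrix.cons_val_one, Matrix.cons_val]
    ring
  have hA : |A.det| ≤ (Fintype.card (Fin 3)).factorial * ∏ j, ![4 * M / (1 + t 0), M, M] j := by
    refine A.abs_det_le_factorial_mul_prod _ fun i j => ?_
    fin_cases j
    · exact he i
    · exact hd i
    · exact (hC₀ _ (by positivity)).trans (hM i).1
  have hV : 0 < (t 0 - t 1) * (t 0 - t 2) * (t 1 - t 2) :=
    mul_pos (mul_pos (by linarith) (by linarith)) (by linarith)
  rw [hdet, abs_mul, abs_of_pos hV]
  gcongr
  refine hA.trans_eq ?_
  simp [Fin.prod_univ_three, Nat.factorial]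
  ring

lemma exists_det_sq_mul_le (r : ℕ) (x : Fin 3 → ℝ) (hx : ∀ i, 0 < x i) :
    ∃ C, 0 ≤ C ∧ ∀ l : Fin 3 → ℝ, (∀ j, 0 < l j) →
      (Matrix.of fun i j => besselG r (x i ^ 2 * l j ^ 2)).det ^ 2
        * (l 0 * l 1 * l 2) ^ (1 + 2 * r) ≤ C := by
  obtain ⟨C, hC⟩ := exists_pow_mul_besselG_sq_le r (2 * r + 1) le_rfl
  obtain ⟨B, hB⟩ : ∃ B, ∀ i, C / x i ^ (2 * r + 1) ≤ B := by
    refine ⟨max (C / x 0 ^ (2 * r + 1)) (max (C / x 1 ^ (2 * r + 1)) (C / x 2 ^ (2 * r + 1))),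
      fun i => ?_⟩
    fin_cases i <;> simp
  have hC0 : 0 ≤ C := by simpa using hC 0 le_rfl
  have hB0 : 0 ≤ B := (div_nonneg hC0 (pow_pos (hx 0) _).le).trans (hB 0)
  refine ⟨36 * B ^ 3, by positivity, fun l hl => ?_⟩
  have hA := (Matrix.of fun i j => besselG r (x i ^ 2 * l j ^ 2)).abs_det_le_factorial_mul_prod
    (fun j => √(B / l j ^ (2 * r + 1))) fun i j => by
      refine Real.abs_le_sqrt ?_
      have h := hC (x i * l j) (mul_pos (hx i) (hl j)).le
      have hxi : 0 < x i ^ (2 * r + 1) := pow_pos (hx i) _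
      have hlj : 0 < l j ^ (2 * r + 1) := pow_pos (hl j) _
      rw [mul_pow, mul_pow] at h
      rw [Matrix.of_apply, le_div_iff₀ hlj]
      refine le_trans ?_ (hB i)
      rw [le_div_iff₀ hxi]
      linarith
  have hp : ∀ j, 0 < l j ^ (2 * r + 1) := fun j => pow_pos (hl j) _
  have hsq := pow_le_pow_left₀ (abs_nonneg _) hA 2
  rw [sq_abs, Fin.prod_univ_three, mul_pow, mul_pow, mul_pow,
    Real.sq_sqrt (div_nonneg hB0 (hp 0).le), Real.sq_sqrt (div_nonneg hB0 (hp 1).le),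
    Real.sq_sqrt (div_nonneg hB0 (hp 2).le)] at hsq
  have hP : 0 < (l 0 * l 1 * l 2) ^ (1 + 2 * r) :=
    pow_pos (mul_pos (mul_pos (hl 0) (hl 1)) (hl 2)) _
  refine (mul_le_mul_of_nonneg_right hsq hP.le).trans_eq ?_
  rw [add_comm 1, mul_pow, mul_pow]
  have := (hp 0).ne'
  have := (hp 1).ne'
  have := (hp 2).ne'
  simp only [Fintype.card_fin, Nat.factorial]
  field_simp
  norm_num [mul_comm]

/-- Rank 3 regular case: for `r ≥ 0`, `x₁ > x₂ > x₃ > 0` and integer `k ≥ 2`, the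
Plancherel test integral over the Weyl chamber `{λ₁ > λ₂ > λ₃ > 0}` is finite, where
`f_r(s) = J_r(s)/s^r`. -/
theorem stmt_17 (r : ℕ) (x₁ x₂ x₃ : ℝ) (hx₃ : 0 < x₃) (hx₂ : x₃ < x₂) (hx₁ : x₂ < x₁)
    (k : ℕ) (hk : 2 ≤ k) :
    ∫⁻ l in {l : Fin 3 → ℝ | 0 < l 2 ∧ l 2 < l 1 ∧ l 1 < l 0},
      ENNReal.ofReal
        (|Matrix.det
            (Matrix.of fun i j : Fin 3 =>
              besselJ r ((![x₁, x₂, x₃] i) * l j) / ((![x₁, x₂, x₃] i) * l j) ^ r)| ^ (2 * k)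
          / (((l 0) ^ 2 - (l 1) ^ 2) ^ (2 * k - 2) * ((l 0) ^ 2 - (l 2) ^ 2) ^ (2 * k - 2)
              * ((l 1) ^ 2 - (l 2) ^ 2) ^ (2 * k - 2))
          * (l 0 * l 1 * l 2) ^ (1 + 2 * r)) < ⊤ := by
  have hx : ∀ i, 0 < ![x₁, x₂, x₃] i := by
    intro i
    fin_cases i
    · exact hx₃.trans (hx₂.trans hx₁)
    · exact hx₃.trans hx₂
    · exact hx₃
  generalize ![x₁, x₂, x₃] = x at hx
  obtain ⟨C₁, hC₁0, hC₁⟩ := exists_abs_det_le_vandermonde r x hx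
  obtain ⟨C₂, hC₂0, hC₂⟩ := exists_det_sq_mul_le r x hx
  have hint : Integrable (fun l : Fin 3 → ℝ => C₂ * C₁ ^ (2 * k - 2) *
      (1 + ‖l‖ ^ 2) ^ (-(4 : ℝ) / 2)) :=
    (integrable_rpow_neg_one_add_norm_sq (by simp; norm_num)).const_mul _
  refine lt_of_le_of_lt (setLIntegral_mono' ?_ fun l hl => ENNReal.ofReal_le_ofReal ?_)
    (hint.restrict (s := {l : Fin 3 → ℝ | 0 < l 2 ∧ l 2 < l 1 ∧ l 1 < l 0})).lintegral_lt_top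
  · refine MeasurableSet.inter ?_ (MeasurableSet.inter ?_ ?_)
    · exact measurableSet_lt measurable_const (measurable_pi_apply _)
    · exact measurableSet_lt (measurable_pi_apply _) (measurable_pi_apply _)
    · exact measurableSet_lt (measurable_pi_apply _) (measurable_pi_apply _)
  obtain ⟨h2, h21, h10⟩ := hl
  have h1 : 0 < l 1 := h2.trans h21
  have h0 : 0 < l 0 := h1.trans h10
  have hl : ∀ j, 0 < l j := by
    intro j
    fin_cases j <;> assumption
  have hJ : (fun i j : Fin 3 => besselJ r (x i * l j) / (x i * l j) ^ r)
      = fun i j => besselG r (x i ^ 2 * l j ^ 2) := by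
    ext i j
    rw [besselJ_div_pow r (mul_pos (hx i) (hl j)).ne', mul_pow]
  rw [hJ]
  have hV := hC₁ (fun j => l j ^ 2) (by positivity) (by gcongr) (by gcongr)
  have hD := hC₂ l hl
  set D := (Matrix.of fun i j => besselG r (x i ^ 2 * l j ^ 2)).det
  rw [← mul_pow, ← mul_pow]
  set V := (l 0 ^ 2 - l 1 ^ 2) * (l 0 ^ 2 - l 2 ^ 2) * (l 1 ^ 2 - l 2 ^ 2)
  have hVpos : 0 < V := by
    have e1 : l 1 ^ 2 < l 0 ^ 2 := by gcongr
    have e2 : l 2 ^ 2 < l 1 ^ 2 := by gcongr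
    exact mul_pos (mul_pos (by linarith) (by linarith)) (by linarith)
  have hnorm : ‖l‖ ≤ l 0 := by
    rw [pi_norm_le_iff_of_nonneg h0.le]
    intro j
    rw [Real.norm_of_nonneg (hl j).le]
    fin_cases j
    · exact le_rfl
    · exact h10.le
    · exact (h21.trans h10).le
  have hk2 : 2 * k = 2 + (2 * k - 2) := by omega
  have hpow : (1 + ‖l‖ ^ 2) ^ (-(4 : ℝ) / 2) = ((1 + ‖l‖ ^ 2)⁻¹) ^ 2 := by
    rw [show -(4 : ℝ) / 2 = -((2 : ℕ) : ℝ) by norm_num, Real.rpow_neg (by positivity),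
      Real.rpow_natCast, inv_pow]
  calc |D| ^ (2 * k) / V ^ (2 * k - 2) * (l 0 * l 1 * l 2) ^ (1 + 2 * r)
      = D ^ 2 * (l 0 * l 1 * l 2) ^ (1 + 2 * r) * (|D| / V) ^ (2 * k - 2) := by
        conv_lhs => rw [hk2, pow_add, sq_abs, Nat.add_sub_cancel_left]
        rw [div_pow]
        ring
    _ ≤ C₂ * (C₁ / (1 + l 0 ^ 2)) ^ (2 * k - 2) := by
        have hDV : |D| / V ≤ C₁ / (1 + l 0 ^ 2) := by rwa [div_le_iff₀ hVpos]
        exact mul_le_mul hD (pow_le_pow_left₀ (by positivity) hDV _) (by positivity) hC₂0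
    _ = C₂ * C₁ ^ (2 * k - 2) * ((1 + l 0 ^ 2)⁻¹) ^ (2 * k - 2) := by
        rw [div_eq_mul_inv, mul_pow, mul_assoc]
    _ ≤ C₂ * C₁ ^ (2 * k - 2) * ((1 + l 0 ^ 2)⁻¹) ^ 2 := by
        gcongr ?_ * ?_
        refine pow_le_pow_of_le_one (by positivity) (inv_le_one_of_one_le₀ ?_) (by omega)
        linarith [sq_nonneg (l 0)]
    _ ≤ C₂ * C₁ ^ (2 * k - 2) * (1 + ‖l‖ ^ 2) ^ (-(4 : ℝ) / 2) := by
        rw [hpow]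
        gcongr
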